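/- Let K satisfy the size condition (1.2) and the non-smooth regularity condition (1.7) with exponent gamma in (0,1], let delta > 0, let K^delta be the smooth truncation of K, and let b be in C_c^infinity(R^n). For 0 < eta < 1, t in R^n with 8|t| < eta, and x in R^n, set B(x) = int int over {(y1,y2): min(|x-y1|,|x-y2|) > eta} of ( K^delta(x,y1,y2) - K^delta(x+t,y1,y2) ) (b(y1) - b(x+t)) f1(y1) f2(y2) dy1 dy2. Then there is a constant C, independent of x, t, eta, delta, f1 and f2, such that for all bounded compactly supported f1,f2: |B(x)| <= C ||b||_{L^infinity} (|t|/eta)^gamma M(f1,f2)(x). -/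

import Mathlib

open MeasureTheory ENNReal Set

noncomputable section

/-- Euclidean space `ℝⁿ`. -/
abbrev Rn (n : ℕ) := EuclideanSpace ℝ (Fin n)

/-- An axis-parallel cube in `ℝⁿ`, given by its center and (positive) side length. -/
structure Cube (n : ℕ) where
  center : Rn n
  side : ℝ
  side_pos : 0 < side

namespace Cube

variable {n : ℕ}

/-- The set of points of a cube. -/
def toSet (Q : Cube n) : Set (Rn n) := {y | ∀ i, |y i - Q.center i| ≤ Q.side / 2}

/-- The volume `|Q| = ℓ(Q)ⁿ` of a cube. -/
def vol (Q : Cube n) : ℝ := Q.side ^ n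

/-- The dilate `2^k Q`: same center, side length `2^k ℓ(Q)`. -/
def dilate (Q : Cube n) (k : ℕ) : Cube n := ⟨Q.center, 2 ^ k * Q.side, by have := Q.side_pos; positivity⟩

end Cube

instance {n : ℕ} : Nonempty (Cube n) := ⟨⟨0, 1, one_pos⟩⟩

variable {n : ℕ}

/-- Average of a real function over a cube. -/
def cubeAvg (Q : Cube n) (f : Rn n → ℝ) : ℝ := (Q.vol)⁻¹ * ∫ y in Q.toSet, f y

/-- Mean oscillation of `b` over cube `Q`. -/
def bmoDev (Q : Cube n) (b : Rn n → ℝ) : ℝ :=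
  cubeAvg Q (fun y => |b y - cubeAvg Q b|)

/-- The BMO seminorm. -/
def bmoNorm (b : Rn n → ℝ) : ℝ := ⨆ Q : Cube n, bmoDev Q b

/-- Membership in BMO(ℝⁿ). -/
def MemBMO (b : Rn n → ℝ) : Prop :=
  LocallyIntegrable b volume ∧ BddAbove (Set.range fun Q : Cube n => bmoDev Q b)

/-- Membership in CMO(ℝⁿ): the closure of `C_c^∞` in the BMO norm. -/
def MemCMO (b : Rn n → ℝ) : Prop :=
  MemBMO b ∧ ∀ ε : ℝ, 0 < ε → ∃ g : Rn n → ℝ, ContDiff ℝ (⊤ : ℕ∞) g ∧ HasCompactSupport g ∧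
    ∀ Q : Cube n, bmoDev Q (fun y => b y - g y) ≤ ε

/-- The conjugate exponent `p' = p/(p-1)`. -/
def conjExp (p : ℝ) : ℝ := p / (p - 1)

/-- The Muckenhoupt `A_p` condition for a weight `w`. -/
def IsAp (p : ℝ) (w : Rn n → ℝ) : Prop :=
  (∀ x, 0 ≤ w x) ∧ LocallyIntegrable w volume ∧
  ∃ C : ℝ, ∀ Q : Cube n,
    cubeAvg Q w * (cubeAvg Q (fun y => w y ^ (1 - conjExp p))) ^ (p - 1) ≤ C

/-- The weight `ν_{w⃗} = w₁^{p/p₁} w₂^{p/p₂}`. -/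
def nuW (p p1 p2 : ℝ) (w1 w2 : Rn n → ℝ) : Rn n → ℝ :=
  fun x => w1 x ^ (p / p1) * w2 x ^ (p / p2)

/-- The multilinear `A_{p⃗}` condition for the pair of weights `(w₁, w₂)`. -/
def IsApVec (p p1 p2 : ℝ) (w1 w2 : Rn n → ℝ) : Prop :=
  (∀ x, 0 ≤ w1 x) ∧ (∀ x, 0 ≤ w2 x) ∧
  LocallyIntegrable w1 volume ∧ LocallyIntegrable w2 volume ∧
  ∃ C : ℝ, ∀ Q : Cube n,
    (cubeAvg Q (nuW p p1 p2 w1 w2)) ^ (1 / p) *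
    (cubeAvg Q (fun y => w1 y ^ (1 - conjExp p1))) ^ (1 / conjExp p1) *
    (cubeAvg Q (fun y => w2 y ^ (1 - conjExp p2))) ^ (1 / conjExp p2) ≤ C

/-- The condition `R_θ`: `w(E)/w(Q) ≤ C (|E|/|Q|)^θ`. -/
def MemRtheta (θ : ℝ) (w : Rn n → ℝ) : Prop :=
  ∃ C : ℝ, 0 < C ∧ ∀ Q : Cube n, ∀ E ⊆ Q.toSet, MeasurableSet E →
    ∫⁻ x in E, ENNReal.ofReal (w x) ≤
      ENNReal.ofReal C * (volume E / ENNReal.ofReal Q.vol) ^ θ *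
        ∫⁻ x in Q.toSet, ENNReal.ofReal (w x)

/-- Weighted `L^p(w)` norm of a real function, valued in `ℝ≥0∞`. -/
def wLp (p : ℝ) (w : Rn n → ℝ) (f : Rn n → ℝ) : ℝ≥0∞ :=
  (∫⁻ x, ENNReal.ofReal |f x| ^ p * ENNReal.ofReal (w x)) ^ (1 / p)

/-- Weighted `L^p(w)` norm of an `ℝ≥0∞`-valued function. -/
def wLpE (p : ℝ) (w : Rn n → ℝ) (g : Rn n → ℝ≥0∞) : ℝ≥0∞ :=
  (∫⁻ x, g x ^ p * ENNReal.ofReal (w x)) ^ (1 / p)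

/-- `ℝ≥0∞`-valued average of `|f|` over a cube. -/
def avgE (Q : Cube n) (f : Rn n → ℝ) : ℝ≥0∞ :=
  (ENNReal.ofReal Q.vol)⁻¹ * ∫⁻ y in Q.toSet, ENNReal.ofReal |f y|

/-- `ℝ≥0∞`-valued average of an `ℝ≥0∞`-valued function over a cube. -/
def avgE' (Q : Cube n) (g : Rn n → ℝ≥0∞) : ℝ≥0∞ :=
  (ENNReal.ofReal Q.vol)⁻¹ * ∫⁻ y in Q.toSet, g y

/-- The bilinear maximal function `𝓜(f₁,f₂)`. -/
def MM (f1 f2 : Rn n → ℝ) (x : Rn n) : ℝ≥0∞ :=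
  ⨆ (Q : Cube n) (_ : x ∈ Q.toSet), avgE Q f1 * avgE Q f2

/-- The bilinear maximal operator `𝓜_{2,1}` of Grafakos–Liu–Yang. -/
def M21 (f1 f2 : Rn n → ℝ) (x : Rn n) : ℝ≥0∞ :=
  ⨆ (Q : Cube n) (_ : x ∈ Q.toSet),
    ∑' k : ℕ, ENNReal.ofReal ((2:ℝ) ^ (-((k : ℝ) * n))) * avgE Q f1 * avgE (Q.dilate k) f2

/-- The bilinear maximal operator `𝓜_{2,2}`. -/
def M22 (f1 f2 : Rn n → ℝ) (x : Rn n) : ℝ≥0∞ :=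
  ⨆ (Q : Cube n) (_ : x ∈ Q.toSet),
    ∑' k : ℕ, ENNReal.ofReal ((2:ℝ) ^ (-((k : ℝ) * n))) * avgE Q f2 * avgE (Q.dilate k) f1

/-- Hu's bilinear maximal operator `𝓜¹_β`, with sum over `k ≥ 1`. -/
def M1beta (β : ℝ) (f1 f2 : Rn n → ℝ) (x : Rn n) : ℝ≥0∞ :=
  ⨆ (Q : Cube n) (_ : x ∈ Q.toSet),
    avgE Q f1 * ∑' k : ℕ,
      ENNReal.ofReal ((2:ℝ) ^ (((k : ℝ) + 1) * (β - n))) * avgE (Q.dilate (k + 1)) f2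

/-- Hu's bilinear maximal operator `𝓜²_β`, with sum over `k ≥ 1`. -/
def M2beta (β : ℝ) (f1 f2 : Rn n → ℝ) (x : Rn n) : ℝ≥0∞ :=
  ⨆ (Q : Cube n) (_ : x ∈ Q.toSet),
    avgE Q f2 * ∑' k : ℕ,
      ENNReal.ofReal ((2:ℝ) ^ (((k : ℝ) + 1) * (β - n))) * avgE (Q.dilate (k + 1)) f1

/-- The maximal operator `M_δ f = M(|f|^δ)^{1/δ}` (Hardy–Littlewood for `δ = 1`). -/
def Mdelta (δ : ℝ) (f : Rn n → ℝ) (x : Rn n) : ℝ≥0∞ :=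
  (⨆ (Q : Cube n) (_ : x ∈ Q.toSet),
    avgE' Q (fun y => ENNReal.ofReal |f y| ^ δ)) ^ (1 / δ)

/-- The Fefferman–Stein sharp maximal operator `M^{♯}_δ f = M^{♯}(|f|^δ)^{1/δ}`. -/
def sharpDelta (δ : ℝ) (f : Rn n → ℝ) (x : Rn n) : ℝ≥0∞ :=
  (⨆ (Q : Cube n) (_ : x ∈ Q.toSet),
    ⨅ c : ℝ, avgE' Q (fun y => ENNReal.ofReal |(|f y| ^ δ) - c|)) ^ (1 / δ)

/-- `Φ(t) = t (1 + log⁺ t)`. -/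
def PhiLL (t : ℝ) : ℝ := t * (1 + max (Real.log t) 0)

/-- The `L(log L)` Luxemburg norm of `f` over the cube `Q`. -/
def llogNorm (Q : Cube n) (f : Rn n → ℝ) : ℝ :=
  sInf {lam : ℝ | 0 < lam ∧
    ∫⁻ y in Q.toSet, ENNReal.ofReal (PhiLL (|f y| / lam)) ≤ ENNReal.ofReal Q.vol}

/-- The bilinear maximal operator `𝓜_{L(log L)}`. -/
def MLlogL (f1 f2 : Rn n → ℝ) (x : Rn n) : ℝ≥0∞ :=
  ⨆ (Q : Cube n) (_ : x ∈ Q.toSet), ENNReal.ofReal (llogNorm Q f1 * llogNorm Q f2)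

/-- The size condition (1.2) with constant `A`. -/
def SizeCond (K : Rn n → Rn n → Rn n → ℝ) (A : ℝ) : Prop :=
  ∀ x y1 y2 : Rn n, (x ≠ y1 ∨ x ≠ y2) →
    |K x y1 y2| ≤ A / (dist x y1 + dist x y2) ^ (2 * (n : ℝ))

/-- The non-smooth regularity condition (1.7) with constant `D` and exponent `γ`. -/
def RegCond (K : Rn n → Rn n → Rn n → ℝ) (D γ : ℝ) : Prop :=
  ∀ x x' y1 y2 : Rn n, ∀ τ : ℝ,
    8 * dist x x' < min (dist x y1) (dist x y2) →
    2 * dist x x' < τ → 4 * τ < min (dist x y1) (dist x y2) →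
    |K x y1 y2 - K x' y1 y2| ≤ D * τ ^ γ / (dist x y1 + dist x y2) ^ (2 * (n : ℝ) + γ)

/-- Bounded, measurable, compactly supported function. -/
def BCS (f : Rn n → ℝ) : Prop :=
  Measurable f ∧ HasCompactSupport f ∧ ∃ M : ℝ, ∀ x, |f x| ≤ M

/-- `T` is the bilinear singular integral operator associated with the kernel `K`
in the sense of (1.1). -/
def AssocKernel (T : (Rn n → ℝ) → (Rn n → ℝ) → Rn n → ℝ)
    (K : Rn n → Rn n → Rn n → ℝ) : Prop :=
  ∀ f1 f2 : Rn n → ℝ, BCS f1 → BCS f2 → ∀ x : Rn n,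
    x ∉ tsupport f1 ∩ tsupport f2 →
    T f1 f2 x = ∫ z : Rn n × Rn n, K x z.1 z.2 * f1 z.1 * f2 z.2

/-- Condition (1.6): `T` maps `L¹ × L¹` boundedly into `L^{1/2,∞}`. -/
def WeakTypeBound (T : (Rn n → ℝ) → (Rn n → ℝ) → Rn n → ℝ) : Prop :=
  ∃ B : ℝ, 0 < B ∧ ∀ f1 f2 : Rn n → ℝ, Integrable f1 volume → Integrable f2 volume →
    ∀ lam : ℝ, 0 < lam →
      volume {x | lam < |T f1 f2 x|} ≤
        ENNReal.ofReal ((B * (∫ y, |f1 y|) * (∫ y, |f2 y|) / lam) ^ ((1:ℝ) / 2))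

/-- The commutator `[b,T]₁(f₁,f₂) = T(b f₁, f₂) - b T(f₁,f₂)`. -/
def comm1 (b : Rn n → ℝ) (T : (Rn n → ℝ) → (Rn n → ℝ) → Rn n → ℝ)
    (f1 f2 : Rn n → ℝ) : Rn n → ℝ :=
  fun x => T (fun y => b y * f1 y) f2 x - b x * T f1 f2 x

/-- The commutator `[b,T]₂(f₁,f₂) = T(f₁, b f₂) - b T(f₁,f₂)`. -/
def comm2 (b : Rn n → ℝ) (T : (Rn n → ℝ) → (Rn n → ℝ) → Rn n → ℝ)
    (f1 f2 : Rn n → ℝ) : Rn n → ℝ :=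
  fun x => T f1 (fun y => b y * f2 y) x - b x * T f1 f2 x

/-- The iterated commutator `T_{b⃗} = [b₂,[b₁,T]₁]₂`. -/
def itComm (b1 b2 : Rn n → ℝ) (T : (Rn n → ℝ) → (Rn n → ℝ) → Rn n → ℝ)
    (f1 f2 : Rn n → ℝ) : Rn n → ℝ :=
  comm2 b2 (comm1 b1 T) f1 f2

/-- The triple product space `ℝ^{3n}`. -/
abbrev E3 (n : ℕ) := Rn n × Rn n × Rn n

/-- A nonnegative `C_c^∞` bump function on `ℝ^{3n}` supported in
`{max(|x|,|y₁|,|y₂|) < 1}` with integral `1`. -/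
def GoodPhi (φ : E3 n → ℝ) : Prop :=
  ContDiff ℝ (⊤ : ℕ∞) φ ∧ HasCompactSupport φ ∧ (∀ u, 0 ≤ φ u) ∧
  tsupport φ ⊆ {u : E3 n | max ‖u.1‖ (max ‖u.2.1‖ ‖u.2.2‖) < 1} ∧
  ∫ u : E3 n, φ u = 1

/-- The smooth truncation `ψ^δ = φ_δ * χ^δ`. -/
def psiDelta (φ : E3 n → ℝ) (δ : ℝ) (u : E3 n) : ℝ :=
  ∫ v : E3 n, ((δ / 4) ^ (3 * n))⁻¹ * φ ((4 / δ) • (u - v)) *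
    Set.indicator {w : E3 n | 3 * δ / 2 ≤ max (dist w.1 w.2.1) (dist w.1 w.2.2)}
      (fun _ => (1:ℝ)) v

/-- The truncated kernel `K^δ = ψ^δ K`. -/
def Kdelta (φ : E3 n → ℝ) (δ : ℝ) (K : Rn n → Rn n → Rn n → ℝ) :
    Rn n → Rn n → Rn n → ℝ :=
  fun x y1 y2 => psiDelta φ δ (x, y1, y2) * K x y1 y2

/-- The truncated bilinear operator `T^δ` associated with `K^δ`. -/
def Tdelta (φ : E3 n → ℝ) (δ : ℝ) (K : Rn n → Rn n → Rn n → ℝ)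
    (f1 f2 : Rn n → ℝ) : Rn n → ℝ :=
  fun x => ∫ z : Rn n × Rn n, Kdelta φ δ K x z.1 z.2 * f1 z.1 * f2 z.2

/-- The maximal truncated bilinear singular integral operator `T^*`. -/
def Tstar (K : Rn n → Rn n → Rn n → ℝ) (f1 f2 : Rn n → ℝ) (x : Rn n) : ℝ≥0∞ :=
  ⨆ (η : ℝ) (_ : 0 < η), ENNReal.ofReal
    |∫ z : Rn n × Rn n,
      Set.indicator {z : Rn n × Rn n | η < max (dist x z.1) (dist x z.2)}
        (fun z => K x z.1 z.2 * f1 z.1 * f2 z.2) z|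

end

instance aux_haar2 {n : ℕ} : (volume : Measure (Rn n × Rn n)).IsAddHaarMeasure :=
  inferInstanceAs ((volume : Measure (Rn n)).prod (volume : Measure (Rn n))).IsAddHaarMeasure

instance aux_haar3 {n : ℕ} : (volume : Measure (E3 n)).IsAddHaarMeasure :=
  Measure.prod.instIsAddHaarMeasure (volume : Measure (Rn n)) (volume : Measure (Rn n × Rn n))

lemma aux_psi_eq {n : ℕ} (φ : E3 n → ℝ) (δ : ℝ) (hδ : 0 < δ) (u : E3 n) :
    psiDelta φ δ u = ∫ w : E3 n, φ w *
      Set.indicator {w : E3 n | 3 * δ / 2 ≤ max (dist w.1 w.2.1) (dist w.1 w.2.2)}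
      (fun _ => (1:ℝ)) (u - (δ / 4) • w) := by
  set χ := Set.indicator {w : E3 n | 3 * δ / 2 ≤ max (dist w.1 w.2.1) (dist w.1 w.2.2)}
      (fun _ => (1:ℝ)) with hχ
  have h1 : psiDelta φ δ u =
      ∫ v : E3 n, ((δ / 4) ^ (3 * n))⁻¹ * (φ ((4 / δ) • (-v)) * χ (v + u)) := by
    unfold psiDelta
    rw [← integral_add_right_eq_self _ u]
    congr 1
    ext v
    have : u - (v + u) = -v := by abel
    rw [this, mul_assoc]
  rw [h1, integral_const_mul]
  have h2 := MeasureTheory.Measure.integral_comp_smul (volume : Measure (E3 n))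
    (fun v => φ ((4 / δ) • (-v)) * χ (v + u)) (-(δ / 4))
  have hfr : Module.finrank ℝ (E3 n) = 3 * n := by
    simp [Module.finrank_prod]; ring
  rw [hfr] at h2
  have hp : 0 < δ / 4 := by positivity
  rw [abs_inv, abs_pow, abs_neg, abs_of_pos hp, smul_eq_mul] at h2
  rw [← h2]
  congr 1
  ext w
  have e1 : (4 / δ) • (-(-(δ / 4) • w)) = w := by
    rw [neg_smul, neg_neg, smul_smul]
    have : 4 / δ * (δ / 4) = 1 := by field_simp
    rw [this, one_smul]
  have e2 : -(δ / 4) • w + u = u - (δ / 4) • w := by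
    rw [neg_smul]; abel
  rw [e1, e2]

lemma aux_chi_meas {n : ℕ} (δ : ℝ) : Measurable (Set.indicator
    {w : E3 n | 3 * δ / 2 ≤ max (dist w.1 w.2.1) (dist w.1 w.2.2)} (fun _ => (1:ℝ))) := by
  apply Measurable.indicator measurable_const
  apply IsClosed.measurableSet
  exact isClosed_le continuous_const (by fun_prop)

lemma aux_chi_abs {n : ℕ} (δ : ℝ) (v : E3 n) : |Set.indicator
    {w : E3 n | 3 * δ / 2 ≤ max (dist w.1 w.2.1) (dist w.1 w.2.2)} (fun _ => (1:ℝ)) v| ≤ 1 := by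
  by_cases h : v ∈ {w : E3 n | 3 * δ / 2 ≤ max (dist w.1 w.2.1) (dist w.1 w.2.2)}
  · rw [Set.indicator_of_mem h]; simp
  · rw [Set.indicator_of_notMem h]; simp

lemma aux_int {n : ℕ} (g : E3 n → ℝ) (hg : Integrable g) (δ : ℝ) (u : E3 n) :
    Integrable (fun w => g w * Set.indicator
    {w : E3 n | 3 * δ / 2 ≤ max (dist w.1 w.2.1) (dist w.1 w.2.2)} (fun _ => (1:ℝ))
      (u - (δ / 4) • w)) := by
  apply hg.mul_bdd (c := 1)
  · exact ((aux_chi_meas δ).comp (by fun_prop)).aestronglyMeasurable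
  · exact Filter.Eventually.of_forall fun w => by rw [Real.norm_eq_abs]; exact aux_chi_abs δ _

lemma aux_phi_int {n : ℕ} {φ : E3 n → ℝ} (hφ : GoodPhi φ) : Integrable φ :=
  hφ.1.continuous.integrable_of_hasCompactSupport hφ.2.1

lemma aux_psi_abs {n : ℕ} {φ : E3 n → ℝ} (hφ : GoodPhi φ) (δ : ℝ) (hδ : 0 < δ) (u : E3 n) :
    |psiDelta φ δ u| ≤ 1 := by
  rw [aux_psi_eq φ δ hδ u, ← Real.norm_eq_abs]
  refine (norm_integral_le_integral_norm _).trans ?_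
  refine le_of_le_of_eq ?_ hφ.2.2.2.2
  apply integral_mono (aux_int φ (aux_phi_int hφ) δ u).norm (aux_phi_int hφ)
  intro w
  simp only [norm_mul, Real.norm_eq_abs]
  rw [abs_of_nonneg (hφ.2.2.1 w)]
  exact mul_le_of_le_one_right (hφ.2.2.1 w) (aux_chi_abs δ _)

lemma aux_psi_one {n : ℕ} {φ : E3 n → ℝ} (hφ : GoodPhi φ) (δ : ℝ) (hδ : 0 < δ) (u : E3 n)
    (hu : 2 * δ ≤ max (dist u.1 u.2.1) (dist u.1 u.2.2)) : psiDelta φ δ u = 1 := by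
  rw [aux_psi_eq φ δ hδ u]
  refine Eq.trans ?_ hφ.2.2.2.2
  congr 1
  ext w
  by_cases hw : φ w = 0
  · simp [hw]
  have hs := hφ.2.2.2.1 (subset_tsupport φ hw)
  simp only [Set.mem_ofPred_eq, max_lt_iff] at hs
  obtain ⟨h0, h1, h2⟩ := hs
  rw [Set.indicator_of_mem, mul_one]
  simp only [Set.mem_ofPred_eq, Prod.fst_sub, Prod.snd_sub, Prod.smul_fst, Prod.smul_snd]
  have key : ∀ a c p q : Rn n, ‖p‖ < 1 → ‖q‖ < 1 →
      dist a c - δ / 2 ≤ dist (a - (δ / 4) • p) (c - (δ / 4) • q) := by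
    intro a c p q hp hq
    have e : a - c = ((a - (δ / 4) • p) - (c - (δ / 4) • q)) + ((δ / 4) • p - (δ / 4) • q) := by
      abel
    rw [dist_eq_norm, dist_eq_norm]
    have h3 := norm_add_le ((a - (δ / 4) • p) - (c - (δ / 4) • q)) ((δ / 4) • p - (δ / 4) • q)
    rw [← e] at h3
    have h4 := norm_sub_le ((δ / 4) • p) ((δ / 4) • q)
    rw [norm_smul, norm_smul, Real.norm_of_nonneg (by positivity)] at h4
    nlinarith
  have k1 := key u.1 u.2.1 w.1 w.2.1 h0 h1
  have k2 := key u.1 u.2.2 w.1 w.2.2 h0 h2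
  rcases le_max_iff.1 hu with h | h
  · exact le_max_of_le_left (by linarith)
  · exact le_max_of_le_right (by linarith)

lemma aux_psi_lip {n : ℕ} {φ : E3 n → ℝ} (hφ : GoodPhi φ) :
    ∃ L : ℝ, 0 < L ∧ ∀ δ : ℝ, 0 < δ → ∀ u u' : E3 n,
      |psiDelta φ δ u - psiDelta φ δ u'| ≤ L * (‖u - u'‖ / δ) := by
  obtain ⟨C, hC⟩ := ContDiff.lipschitzWith_of_hasCompactSupport hφ.2.1 hφ.1 (by simp)
  set S := tsupport φ with hS
  have hSm : MeasurableSet S := (isClosed_tsupport φ).measurableSet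
  have hSc : IsCompact S := hφ.2.1
  set V := (volume : Measure (E3 n)).real S with hV
  have hV0 : 0 ≤ V := measureReal_nonneg
  refine ⟨8 * C * V + 1, by positivity, ?_⟩
  intro δ hδ u u'
  set s : E3 n := (4 / δ) • (u' - u) with hs
  set χ := Set.indicator {w : E3 n | 3 * δ / 2 ≤ max (dist w.1 w.2.1) (dist w.1 w.2.2)}
      (fun _ => (1:ℝ)) with hχ
  have h2 : psiDelta φ δ u' = ∫ w, φ (w + s) * χ (u - (δ / 4) • w) := by
    rw [aux_psi_eq φ δ hδ u', ← integral_add_right_eq_self _ s]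
    congr 1
    ext w
    congr 2
    rw [hs, smul_add, smul_smul]
    have : δ / 4 * (4 / δ) = 1 := by field_simp
    rw [this, one_smul]
    abel
  have hi := aux_phi_int hφ
  have hi2 : Integrable (fun w => φ (w + s)) := hi.comp_add_right s
  have hind : Integrable (S.indicator (fun _ => (1:ℝ))) :=
    (integrable_indicator_iff hSm).2 (integrableOn_const hSc.measure_lt_top.ne)
  have hind2 : Integrable (fun w => S.indicator (fun _ => (1:ℝ)) (w + s)) := hind.comp_add_right s
  have hval : ∫ w, S.indicator (fun _ => (1:ℝ)) w = V := by
    rw [integral_indicator hSm]; simp [hV]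
  rw [h2, aux_psi_eq φ δ hδ u, ← integral_sub (aux_int φ hi δ u) (aux_int _ hi2 δ u),
    ← Real.norm_eq_abs]
  refine (norm_integral_le_integral_norm _).trans ?_
  have hb : ∫ w, ‖φ w * χ (u - (δ / 4) • w) - φ (w + s) * χ (u - (δ / 4) • w)‖ ≤
      ∫ w, (C * ‖s‖) * (S.indicator (fun _ => (1:ℝ)) w + S.indicator (fun _ => (1:ℝ)) (w + s)) := by
    apply integral_mono ((aux_int φ hi δ u).sub (aux_int _ hi2 δ u)).norm
      ((hind.add hind2).const_mul _)
    intro w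
    show ‖φ w * χ (u - (δ / 4) • w) - φ (w + s) * χ (u - (δ / 4) • w)‖ ≤
      (C * ‖s‖) * (S.indicator (fun _ => (1:ℝ)) w + S.indicator (fun _ => (1:ℝ)) (w + s))
    rw [← sub_mul, norm_mul]
    have hx : ‖χ (u - (δ / 4) • w)‖ ≤ 1 := by rw [Real.norm_eq_abs]; exact aux_chi_abs δ _
    refine (mul_le_of_le_one_right (norm_nonneg _) hx).trans ?_
    have hl : ‖φ w - φ (w + s)‖ ≤ C * ‖s‖ := by
      have := hC.dist_le_mul w (w + s)
      rw [dist_eq_norm] at this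
      simpa using this
    have hp : 0 ≤ C * ‖s‖ := by positivity
    have n1 : 0 ≤ S.indicator (fun _ => (1:ℝ)) w := Set.indicator_nonneg (by simp) _
    have n2 : 0 ≤ S.indicator (fun _ => (1:ℝ)) (w + s) := Set.indicator_nonneg (by simp) _
    by_cases ha : w ∈ S
    · rw [Set.indicator_of_mem ha]; nlinarith
    by_cases hb : w + s ∈ S
    · rw [Set.indicator_of_mem hb]; nlinarith
    rw [image_eq_zero_of_notMem_tsupport ha, image_eq_zero_of_notMem_tsupport hb]
    simp only [sub_zero, norm_zero]
    positivity
  refine hb.trans ?_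
  rw [integral_const_mul, integral_add hind hind2,
    integral_add_right_eq_self (fun w => S.indicator (fun _ => (1:ℝ)) w) s, hval]
  have hns : ‖s‖ = 4 * (‖u - u'‖ / δ) := by
    rw [hs, norm_smul, Real.norm_of_nonneg (by positivity), norm_sub_rev]; ring
  rw [hns]
  have : 0 ≤ ‖u - u'‖ / δ := by positivity
  nlinarith

/-- Pointwise kernel estimate. -/
lemma aux_kernel {n : ℕ} (K : Rn n → Rn n → Rn n → ℝ)
    (A0 D γ : ℝ) (hA0 : 0 < A0) (hD : 0 < D) (hγ0 : 0 < γ) (hγ1 : γ ≤ 1)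
    (hsize : SizeCond K A0) (hreg : RegCond K D γ)
    (φ : E3 n → ℝ) (hφ : GoodPhi φ) :
    ∃ C : ℝ, 0 < C ∧ ∀ δ : ℝ, 0 < δ → ∀ η : ℝ, 0 < η → ∀ t : Rn n, 8 * ‖t‖ < η → t ≠ 0 →
      ∀ x y1 y2 : Rn n, η < min (dist x y1) (dist x y2) →
        |Kdelta φ δ K x y1 y2 - Kdelta φ δ K (x + t) y1 y2| ≤
          C * ‖t‖ ^ γ * (max (dist x y1) (dist x y2)) ^ (-(2 * (n : ℝ) + γ)) := by
  obtain ⟨L, hL, hlip⟩ := aux_psi_lip hφ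
  refine ⟨3 * L * A0 + D * 3, by positivity, ?_⟩
  intro δ hδ η hη t ht ht0 x y1 y2 hy
  have htp : 0 < ‖t‖ := norm_pos_iff.2 ht0
  set m := max (dist x y1) (dist x y2) with hm
  have hηm : η < m := hy.trans_le (min_le_max)
  have hm0 : 0 < m := hη.trans hηm
  have hSm : m ≤ dist x y1 + dist x y2 :=
    max_le (by linarith [dist_nonneg (x := x) (y := y2)]) (by linarith [dist_nonneg (x := x) (y := y1)])
  have hdt : dist x (x + t) = ‖t‖ := by simp [dist_eq_norm]
  set S := dist x y1 + dist x y2 with hS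
  have hS0 : 0 < S := hm0.trans_le hSm
  -- the size bound
  have hK : |K x y1 y2| ≤ A0 * m ^ (-(2 * (n : ℝ))) := by
    have hne : x ≠ y1 := by
      intro h
      have := hy.trans_le (min_le_left _ _)
      rw [h, dist_self] at this
      linarith
    refine (hsize x y1 y2 (Or.inl hne)).trans ?_
    rw [Real.rpow_neg hm0.le, div_eq_mul_inv]
    have : m ^ (2 * (n : ℝ)) ≤ S ^ (2 * (n : ℝ)) := Real.rpow_le_rpow hm0.le hSm (by positivity)
    have h0 : 0 < m ^ (2 * (n : ℝ)) := Real.rpow_pos_of_pos hm0 _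
    gcongr
  -- the regularity bound
  have hKd : |K x y1 y2 - K (x + t) y1 y2| ≤
      D * 3 * ‖t‖ ^ γ * m ^ (-(2 * (n : ℝ) + γ)) := by
    set τ := min (3 * ‖t‖) ((2 * ‖t‖ + η / 4) / 2) with hτ
    have hτ1 : 2 * ‖t‖ < τ := lt_min (by linarith) (by linarith)
    have hτ2 : 4 * τ < η := by
      have := min_le_right (3 * ‖t‖) ((2 * ‖t‖ + η / 4) / 2)
      linarith
    have hτ3 : τ ≤ 3 * ‖t‖ := min_le_left _ _
    have hτ0 : 0 < τ := by linarith
    have := hreg x (x + t) y1 y2 τ (by rw [hdt]; linarith) (by rw [hdt]; exact hτ1) (by linarith)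
    refine this.trans ?_
    rw [Real.rpow_neg hm0.le, div_eq_mul_inv]
    have h1 : m ^ (2 * (n : ℝ) + γ) ≤ S ^ (2 * (n : ℝ) + γ) :=
      Real.rpow_le_rpow hm0.le hSm (by positivity)
    have h0 : 0 < m ^ (2 * (n : ℝ) + γ) := Real.rpow_pos_of_pos hm0 _
    have h2 : τ ^ γ ≤ 3 * ‖t‖ ^ γ := by
      calc τ ^ γ ≤ (3 * ‖t‖) ^ γ := Real.rpow_le_rpow hτ0.le hτ3 hγ0.le
        _ = 3 ^ γ * ‖t‖ ^ γ := Real.mul_rpow (by norm_num) (norm_nonneg _)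
        _ ≤ 3 * ‖t‖ ^ γ := by
          gcongr
          calc (3:ℝ) ^ γ ≤ 3 ^ (1:ℝ) := Real.rpow_le_rpow_of_exponent_le (by norm_num) hγ1
            _ = 3 := Real.rpow_one 3
    have h3 : D * τ ^ γ ≤ D * 3 * ‖t‖ ^ γ := by
      rw [mul_assoc]; exact mul_le_mul_of_nonneg_left h2 hD.le
    gcongr
  -- the cutoff bound
  have hpsi : |psiDelta φ δ (x, y1, y2) - psiDelta φ δ (x + t, y1, y2)| ≤
      3 * L * (‖t‖ ^ γ * m ^ (-γ)) := by
    by_cases hc : 2 * δ + ‖t‖ ≤ m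
    · have e1 : psiDelta φ δ (x, y1, y2) = 1 := by
        apply aux_psi_one hφ δ hδ
        show 2 * δ ≤ m
        linarith
      have e2 : psiDelta φ δ (x + t, y1, y2) = 1 := by
        apply aux_psi_one hφ δ hδ
        show 2 * δ ≤ max (dist (x + t) y1) (dist (x + t) y2)
        have t1 := dist_triangle x (x + t) y1
        have t2 := dist_triangle x (x + t) y2
        rw [hdt] at t1 t2
        rcases le_max_iff.1 hc with h | h
        · exact le_max_of_le_left (by linarith)
        · exact le_max_of_le_right (by linarith)
      rw [e1, e2, sub_self, abs_zero]
      positivity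
    · push Not at hc
      refine (hlip δ hδ _ _).trans ?_
      have hn : ‖((x, y1, y2) : E3 n) - (x + t, y1, y2)‖ = ‖t‖ := by
        simp [Prod.norm_def]
      rw [hn]
      have hmd : m ≤ 3 * δ := by linarith
      have h1 : ‖t‖ / δ ≤ 3 * (‖t‖ / m) := by
        rw [div_le_iff₀ hδ]
        have : 3 * (‖t‖ / m) * δ = ‖t‖ * (3 * δ) / m := by ring
        rw [this, le_div_iff₀ hm0]
        gcongr
      have h2 : ‖t‖ / m ≤ (‖t‖ / m) ^ γ := by
        calc ‖t‖ / m = (‖t‖ / m) ^ (1:ℝ) := (Real.rpow_one _).symm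
          _ ≤ (‖t‖ / m) ^ γ := Real.rpow_le_rpow_of_exponent_ge (by positivity)
              (by rw [div_le_one hm0]; linarith) hγ1
      rw [Real.div_rpow (norm_nonneg _) hm0.le, div_eq_mul_inv (‖t‖ ^ γ), ← Real.rpow_neg hm0.le] at h2
      nlinarith
  have hdec : Kdelta φ δ K x y1 y2 - Kdelta φ δ K (x + t) y1 y2 =
      (psiDelta φ δ (x, y1, y2) - psiDelta φ δ (x + t, y1, y2)) * K x y1 y2 +
      psiDelta φ δ (x + t, y1, y2) * (K x y1 y2 - K (x + t) y1 y2) := by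
    unfold Kdelta; ring
  rw [hdec]
  refine (abs_add_le _ _).trans ?_
  rw [abs_mul, abs_mul]
  have hsplit : m ^ (-(2 * (n : ℝ) + γ)) = m ^ (-γ) * m ^ (-(2 * (n : ℝ))) := by
    rw [← Real.rpow_add hm0]; congr 1; ring
  have a1 : |psiDelta φ δ (x, y1, y2) - psiDelta φ δ (x + t, y1, y2)| * |K x y1 y2| ≤
      3 * L * (‖t‖ ^ γ * m ^ (-γ)) * (A0 * m ^ (-(2 * (n : ℝ)))) :=
    mul_le_mul hpsi hK (abs_nonneg _) (by positivity)
  have a2 : |psiDelta φ δ (x + t, y1, y2)| * |K x y1 y2 - K (x + t) y1 y2| ≤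
      D * 3 * ‖t‖ ^ γ * m ^ (-(2 * (n : ℝ) + γ)) :=
    (mul_le_of_le_one_left (abs_nonneg _) (aux_psi_abs hφ δ hδ _)).trans hKd
  calc _ ≤ _ := add_le_add a1 a2
    _ = _ := by rw [hsplit]; ring

/-- The dyadic decomposition estimate. -/
lemma aux_dyadic {n : ℕ} (γ : ℝ) (hγ0 : 0 < γ) (f1 f2 : Rn n → ℝ) (hf1 : Measurable f1)
    (hf2 : Measurable f2) (x : Rn n) (η : ℝ) (hη : 0 < η) :
    ∫⁻ z : Rn n × Rn n, Set.indicator {z : Rn n × Rn n | η < min (dist x z.1) (dist x z.2)}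
      (fun z => ENNReal.ofReal ((max (dist x z.1) (dist x z.2)) ^ (-(2 * (n : ℝ) + γ))) *
        (ENNReal.ofReal |f1 z.1| * ENNReal.ofReal |f2 z.2|)) z ≤
    ENNReal.ofReal ((16:ℝ) ^ n * (1 - (2:ℝ) ^ (-γ))⁻¹ * η ^ (-γ)) * MM f1 f2 x := by
  have hr0 : 0 ≤ (2:ℝ) ^ (-γ) := by positivity
  have hr1 : (2:ℝ) ^ (-γ) < 1 := Real.rpow_lt_one_of_one_lt_of_neg (by norm_num) (by linarith)
  let Q : ℕ → Cube n := fun k => ⟨x, 4 * (2 ^ k * η), by positivity⟩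
  have hQm : ∀ k, MeasurableSet (Q k).toSet := by
    intro k
    apply IsClosed.measurableSet
    have : (Q k).toSet = ⋂ i, {y : Rn n | |y i - x i| ≤ (Q k).side / 2} := by
      ext y; simp [Cube.toSet, Q]
    rw [this]
    exact isClosed_iInter fun i => isClosed_le (by fun_prop) continuous_const
  have hball : ∀ k (y : Rn n), dist x y ≤ 2 * (2 ^ k * η) → y ∈ (Q k).toSet := by
    intro k y hy i
    have h1 : |y i - x i| ≤ ‖y - x‖ := by
      have := PiLp.norm_apply_le (y - x) i
      simpa using this
    rw [← dist_eq_norm, dist_comm] at h1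
    show |y i - x i| ≤ 4 * (2 ^ k * η) / 2
    linarith
  have hxQ : ∀ k, x ∈ (Q k).toSet := fun k => hball k x (by rw [dist_self]; positivity)
  let F : ℕ → Rn n × Rn n → ℝ≥0∞ := fun k z =>
    ENNReal.ofReal ((2 ^ k * η) ^ (-(2 * (n : ℝ) + γ))) *
      ((Q k).toSet.indicator (fun y => ENNReal.ofReal |f1 y|) z.1 *
       (Q k).toSet.indicator (fun y => ENNReal.ofReal |f2 y|) z.2)
  have hm1 : ∀ k, Measurable ((Q k).toSet.indicator (fun y => ENNReal.ofReal |f1 y|)) := fun k =>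
    (ENNReal.measurable_ofReal.comp hf1.abs).indicator (hQm k)
  have hm2 : ∀ k, Measurable ((Q k).toSet.indicator (fun y => ENNReal.ofReal |f2 y|)) := fun k =>
    (ENNReal.measurable_ofReal.comp hf2.abs).indicator (hQm k)
  have hFm : ∀ k, Measurable (F k) := fun k =>
    (((hm1 k).comp measurable_fst).mul ((hm2 k).comp measurable_snd)).const_mul _
  have hpt : ∀ z : Rn n × Rn n,
      Set.indicator {z : Rn n × Rn n | η < min (dist x z.1) (dist x z.2)}
      (fun z => ENNReal.ofReal ((max (dist x z.1) (dist x z.2)) ^ (-(2 * (n : ℝ) + γ))) *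
        (ENNReal.ofReal |f1 z.1| * ENNReal.ofReal |f2 z.2|)) z ≤ ∑' k, F k z := by
    intro z
    by_cases hz : z ∈ {z : Rn n × Rn n | η < min (dist x z.1) (dist x z.2)}
    · rw [Set.indicator_of_mem hz]
      have hz' : η < min (dist x z.1) (dist x z.2) := hz
      set m := max (dist x z.1) (dist x z.2) with hm
      have hηm : η < m := hz'.trans_le min_le_max
      obtain ⟨k, hk1, hk2⟩ := exists_nat_pow_near (x := m / η) (y := 2)
        ((one_le_div hη).2 hηm.le) (by norm_num)
      rw [le_div_iff₀ hη] at hk1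
      rw [div_lt_iff₀ hη, pow_succ] at hk2
      refine le_trans ?_ (ENNReal.le_tsum k)
      have b1 : z.1 ∈ (Q k).toSet := hball k _ (by linarith [le_max_left (dist x z.1) (dist x z.2)])
      have b2 : z.2 ∈ (Q k).toSet := hball k _ (by linarith [le_max_right (dist x z.1) (dist x z.2)])
      simp only [F]
      rw [Set.indicator_of_mem b1, Set.indicator_of_mem b2]
      gcongr ENNReal.ofReal ?_ * _
      exact Real.rpow_le_rpow_of_nonpos (by positivity) hk1 (by linarith [(Nat.cast_nonneg n : (0:ℝ) ≤ n)])
    · rw [Set.indicator_of_notMem hz]; exact zero_le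
  have hFi : ∀ k, ∫⁻ z, F k z ≤
      ENNReal.ofReal ((16:ℝ) ^ n * η ^ (-γ) * ((2:ℝ) ^ (-γ)) ^ k) * MM f1 f2 x := by
    intro k
    have hv0 : 0 < (Q k).vol := pow_pos (Q k).side_pos n
    have hMM : avgE (Q k) f1 * avgE (Q k) f2 ≤ MM f1 f2 x :=
      le_iSup₂ (f := fun (Q : Cube n) (_ : x ∈ Q.toSet) => avgE Q f1 * avgE Q f2) (Q k) (hxQ k)
    have hI : ∀ f : Rn n → ℝ, ∫⁻ y in (Q k).toSet, ENNReal.ofReal |f y| =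
        ENNReal.ofReal (Q k).vol * avgE (Q k) f := by
      intro f
      unfold avgE
      rw [← mul_assoc, ENNReal.mul_inv_cancel (by simpa using hv0) ENNReal.ofReal_ne_top, one_mul]
    have e1 : ∫⁻ z, F k z = ENNReal.ofReal ((2 ^ k * η) ^ (-(2 * (n : ℝ) + γ))) *
        ((ENNReal.ofReal (Q k).vol * avgE (Q k) f1) * (ENNReal.ofReal (Q k).vol * avgE (Q k) f2)) := by
      simp only [F]
      rw [lintegral_const_mul' _ _ ENNReal.ofReal_ne_top,
        Measure.volume_eq_prod, lintegral_prod_mul (hm1 k).aemeasurable (hm2 k).aemeasurable,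
        lintegral_indicator (hQm k), lintegral_indicator (hQm k), hI, hI]
    have e2 : (2 ^ k * η) ^ (-(2 * (n : ℝ) + γ)) * ((Q k).vol * (Q k).vol) =
        (16:ℝ) ^ n * η ^ (-γ) * ((2:ℝ) ^ (-γ)) ^ k := by
      have ha : (0:ℝ) < 2 ^ k * η := by positivity
      have hvol : (Q k).vol = (4 * (2 ^ k * η)) ^ n := rfl
      have hs : (2 ^ k * η) ^ (-(2 * (n : ℝ) + γ)) =
          (((2 ^ k * η) ^ n) * ((2 ^ k * η) ^ n))⁻¹ * (2 ^ k * η) ^ (-γ) := by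
        rw [neg_add, Real.rpow_add ha, Real.rpow_neg ha.le, two_mul, Real.rpow_add ha,
          Real.rpow_natCast]
      have hg : (2 ^ k * η) ^ (-γ) = ((2:ℝ) ^ (-γ)) ^ k * η ^ (-γ) := by
        rw [Real.mul_rpow (by positivity) hη.le, ← Real.rpow_natCast, ← Real.rpow_natCast,
          ← Real.rpow_mul (by norm_num), ← Real.rpow_mul (by norm_num), mul_comm (k : ℝ)]
      have h16 : (16:ℝ) ^ n = 4 ^ n * 4 ^ n := by rw [← mul_pow]; norm_num
      rw [hs, hg, hvol, mul_pow 4, h16]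
      have : ((2:ℝ) ^ k * η) ^ n ≠ 0 := by positivity
      field_simp
    rw [e1, ← e2, ENNReal.ofReal_mul (by positivity), ENNReal.ofReal_mul hv0.le]
    calc _ = ENNReal.ofReal ((2 ^ k * η) ^ (-(2 * (n : ℝ) + γ))) *
        (ENNReal.ofReal (Q k).vol * ENNReal.ofReal (Q k).vol) *
        (avgE (Q k) f1 * avgE (Q k) f2) := by ring
      _ ≤ _ := by gcongr
  calc _ ≤ ∫⁻ z, ∑' k, F k z := lintegral_mono hpt
    _ = ∑' k, ∫⁻ z, F k z := lintegral_tsum fun k => (hFm k).aemeasurable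
    _ ≤ ∑' k, ENNReal.ofReal ((16:ℝ) ^ n * η ^ (-γ) * ((2:ℝ) ^ (-γ)) ^ k) * MM f1 f2 x :=
      ENNReal.tsum_le_tsum hFi
    _ = _ := by
      rw [ENNReal.tsum_mul_right, ← ENNReal.ofReal_tsum_of_nonneg (fun k => by positivity)
        ((summable_geometric_of_lt_one hr0 hr1).mul_left _), tsum_mul_left,
        tsum_geometric_of_lt_one hr0 hr1]
      congr 2; ring

/-- the estimate for the term `B(x)` in the proof of Theorem 1. -/
theorem stmt18 {n : ℕ} (hn : 0 < n)
    (K : Rn n → Rn n → Rn n → ℝ)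
    (A0 D γ : ℝ) (hA0 : 0 < A0) (hD : 0 < D) (hγ0 : 0 < γ) (hγ1 : γ ≤ 1)
    (hsize : SizeCond K A0) (hreg : RegCond K D γ)
    (φ : E3 n → ℝ) (hφ : GoodPhi φ) :
    ∃ C : ℝ, 0 < C ∧ ∀ δ : ℝ, 0 < δ →
      ∀ b : Rn n → ℝ, ContDiff ℝ (⊤ : ℕ∞) b → HasCompactSupport b →
      ∀ η : ℝ, 0 < η → η < 1 → ∀ t : Rn n, 8 * ‖t‖ < η →
      ∀ f1 f2 : Rn n → ℝ, BCS f1 → BCS f2 → ∀ x : Rn n,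
        ENNReal.ofReal
            |∫ z : Rn n × Rn n,
              Set.indicator {z : Rn n × Rn n | η < min (dist x z.1) (dist x z.2)}
                (fun z => (Kdelta φ δ K x z.1 z.2 - Kdelta φ δ K (x + t) z.1 z.2) *
                  (b z.1 - b (x + t)) * f1 z.1 * f2 z.2) z| ≤
          ENNReal.ofReal (C * (⨆ y : Rn n, |b y|) * (‖t‖ / η) ^ γ) * MM f1 f2 x := by

  obtain ⟨C, hC, hker⟩ := aux_kernel K A0 D γ hA0 hD hγ0 hγ1 hsize hreg φ hφ
  have hr1 : (2:ℝ) ^ (-γ) < 1 := Real.rpow_lt_one_of_one_lt_of_neg (by norm_num) (by linarith)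
  have hr2 : 0 < (1 - (2:ℝ) ^ (-γ))⁻¹ := inv_pos.2 (by linarith)
  refine ⟨2 * C * ((16:ℝ) ^ n * (1 - (2:ℝ) ^ (-γ))⁻¹), by positivity, ?_⟩
  intro δ hδ b hb hbc η hη hη1 t ht f1 f2 hf1 hf2 x
  by_cases ht0 : t = 0
  · subst ht0
    simp
  set B := ⨆ y : Rn n, |b y| with hB
  have hbdd : BddAbove (Set.range fun y => |b y|) := by
    obtain ⟨M, hM⟩ := hbc.exists_bound_of_continuous hb.continuous
    exact ⟨M, by rintro _ ⟨y, rfl⟩; exact hM y⟩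
  have hbB : ∀ y, |b y| ≤ B := fun y => le_ciSup hbdd y
  have hB0 : 0 ≤ B := (abs_nonneg _).trans (hbB x)
  rw [← Real.norm_eq_abs, ofReal_norm]
  refine (enorm_integral_le_lintegral_enorm _).trans ?_
  set c : ℝ := 2 * C * B * ‖t‖ ^ γ with hc
  have hc0 : 0 ≤ c := by positivity
  have hpt : ∀ z : Rn n × Rn n,
      ‖Set.indicator {z : Rn n × Rn n | η < min (dist x z.1) (dist x z.2)}
                (fun z => (Kdelta φ δ K x z.1 z.2 - Kdelta φ δ K (x + t) z.1 z.2) *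
                  (b z.1 - b (x + t)) * f1 z.1 * f2 z.2) z‖ₑ ≤
      ENNReal.ofReal c *
      Set.indicator {z : Rn n × Rn n | η < min (dist x z.1) (dist x z.2)}
      (fun z => ENNReal.ofReal ((max (dist x z.1) (dist x z.2)) ^ (-(2 * (n : ℝ) + γ))) *
        (ENNReal.ofReal |f1 z.1| * ENNReal.ofReal |f2 z.2|)) z := by
    intro z
    by_cases hz : z ∈ {z : Rn n × Rn n | η < min (dist x z.1) (dist x z.2)}
    · rw [Set.indicator_of_mem hz, Set.indicator_of_mem hz]
      have hk := hker δ hδ η hη t ht ht0 x z.1 z.2 hz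
      have hbb : |b z.1 - b (x + t)| ≤ 2 * B :=
        (abs_sub _ _).trans (by linarith [hbB z.1, hbB (x + t)])
      rw [← ofReal_norm, Real.norm_eq_abs, abs_mul, abs_mul, abs_mul,
        ← ENNReal.ofReal_mul (abs_nonneg _), ← ENNReal.ofReal_mul (by positivity),
        ← ENNReal.ofReal_mul hc0]
      apply ENNReal.ofReal_le_ofReal
      have h1 := mul_le_mul hk hbb (abs_nonneg _) (by positivity)
      calc _ ≤ C * ‖t‖ ^ γ * (max (dist x z.1) (dist x z.2)) ^ (-(2 * (n : ℝ) + γ)) * (2 * B) *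
            |f1 z.1| * |f2 z.2| := by gcongr
        _ = _ := by rw [hc]; ring
    · rw [Set.indicator_of_notMem hz, Set.indicator_of_notMem hz]; simp
  refine (lintegral_mono hpt).trans ?_
  rw [lintegral_const_mul' _ _ ENNReal.ofReal_ne_top]
  refine (mul_le_mul_right (aux_dyadic γ hγ0 f1 f2 hf1.1 hf2.1 x η hη) _).trans ?_
  rw [← mul_assoc, ← ENNReal.ofReal_mul hc0]
  apply le_of_eq
  congr 2
  rw [Real.div_rpow (norm_nonneg _) hη.le, div_eq_mul_inv, ← Real.rpow_neg hη.le, hc]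
  ring
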